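/- Fix an integer T ≥ 1 and δ ∈ (0,1). In the stochastic AdaGrad setting (momentum β = 0) with f L-smooth and bounded below, assumptions (A2) and (A3) holding with A = 0 (affine variance noise), for any η, ε > 0, with probability at least 1 − δ one has (1/T)·Σ_{s=1}^T ‖∇f(x_s)‖² ≤ 2·Δ₁·[ (B₁·Δ₁ + G + ε)/T + √(2C/T) ], where Δ, Δ₁, B₁, G are the explicit constants defined from the problem parameters with β = 0 and A = 0. -/

import Mathlib

open MeasureTheory Finset Real

theorem le_add_inner_add_sq_of_lipschitz_gradient {E : Type*} [NormedAddCommGroup E]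
    [InnerProductSpace ℝ E] [CompleteSpace E] {f : E → ℝ} {f' : E → E} {L : ℝ}
    (hf : ∀ p, HasGradientAt f (f' p) p) (hf' : ∀ p q, ‖f' p - f' q‖ ≤ L * ‖p - q‖) (p q : E) :
    f q ≤ f p + inner ℝ (f' p) (q - p) + L / 2 * ‖q - p‖ ^ 2 := by
  set u := q - p with hu
  have hline (t : ℝ) : HasDerivAt (fun t : ℝ => p + t • u) u t := by
    simpa using ((hasDerivAt_id t).smul_const u).const_add p
  have hφ (t : ℝ) : HasDerivAt
      (fun t : ℝ => f (p + t • u) - t * inner ℝ (f' p) u - L / 2 * ‖u‖ ^ 2 * t ^ 2)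
      (inner ℝ (f' (p + t • u)) u - inner ℝ (f' p) u - L * ‖u‖ ^ 2 * t) t := by
    have h1 : HasDerivAt (fun t : ℝ => f (p + t • u)) (inner ℝ (f' (p + t • u)) u) t := by
      simpa [Function.comp_def] using
        (hf (p + t • u)).hasFDerivAt.comp_hasDerivAt t (hline t)
    have h2 := (hasDerivAt_id t).mul_const (inner ℝ (f' p) u)
    have h3 := (hasDerivAt_pow 2 t).const_mul (L / 2 * ‖u‖ ^ 2)
    refine ((h1.sub h2).sub h3).congr_deriv ?_
    norm_num
    ring
  have hanti : AntitoneOn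
      (fun t : ℝ => f (p + t • u) - t * inner ℝ (f' p) u - L / 2 * ‖u‖ ^ 2 * t ^ 2)
      (Set.Icc 0 1) := by
    refine antitoneOn_of_hasDerivWithinAt_nonpos (convex_Icc 0 1)
      (fun t _ => (hφ t).continuousAt.continuousWithinAt)
      (fun t _ => (hφ t).hasDerivWithinAt) fun t ht => ?_
    rw [interior_Icc] at ht
    have hb : inner ℝ (f' (p + t • u) - f' p) u ≤ L * ‖p + t • u - p‖ * ‖u‖ :=
      (real_inner_le_norm _ _).trans (mul_le_mul_of_nonneg_right (hf' _ _) (norm_nonneg _))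
    rw [inner_sub_left, add_sub_cancel_left, norm_smul, Real.norm_of_nonneg ht.1.le] at hb
    nlinarith
  have h := hanti (Set.left_mem_Icc.2 zero_le_one) (Set.right_mem_Icc.2 zero_le_one) zero_le_one
  simp [hu] at h ⊢
  linarith

theorem norm_gradient_sq_le {E : Type*} [NormedAddCommGroup E]
    [InnerProductSpace ℝ E] [CompleteSpace E] {f : E → ℝ} {f' : E → E} {L m : ℝ} (hL : 0 < L)
    (hf : ∀ p, HasGradientAt f (f' p) p) (hf' : ∀ p q, ‖f' p - f' q‖ ≤ L * ‖p - q‖)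
    (hm : ∀ p, m ≤ f p) (p : E) : ‖f' p‖ ^ 2 ≤ 2 * L * (f p - m) := by
  have h := (hm _).trans
    (le_add_inner_add_sq_of_lipschitz_gradient hf hf' p (p - L⁻¹ • f' p))
  simp only [sub_sub_cancel_left, inner_neg_right, inner_smul_right, norm_neg, norm_smul,
    real_inner_self_eq_norm_sq, Real.norm_of_nonneg (inv_nonneg.2 hL.le)] at h
  field_simp at h
  nlinarith

theorem sum_div_sq_sqrt_add_le_log {u w : ℕ → ℝ} {ε : ℝ} (hε : 0 < ε) (hw0 : w 0 = 0)
    (hu : ∀ s, 0 ≤ u s) (hw : ∀ s, 1 ≤ s → w s = w (s - 1) + u s) (t : ℕ) :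
    0 ≤ w t ∧ ∑ s ∈ Icc 1 t, u s / (√(w s) + ε) ^ 2 ≤ log (1 + w t / ε ^ 2) := by
  induction t with
  | zero => simp [hw0]
  | succ t ih =>
    obtain ⟨h0, ih⟩ := ih
    have hstep : w (t + 1) = w t + u (t + 1) := hw (t + 1) (by omega)
    have hu' := hu (t + 1)
    refine ⟨by linarith, ?_⟩
    rw [sum_Icc_succ_top (by omega)]
    have hpos : 0 < ε ^ 2 + w t := by positivity
    have h0' : 0 ≤ w (t + 1) := by linarith
    have hpos' : 0 < ε ^ 2 + w (t + 1) := by linarith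
    have hlog : 1 - (ε ^ 2 + w t) / (ε ^ 2 + w (t + 1)) ≤
        log (1 + w (t + 1) / ε ^ 2) - log (1 + w t / ε ^ 2) := by
      rw [← log_div (by positivity) (by positivity)]
      have := one_sub_inv_le_log_of_pos (div_pos hpos' hpos)
      rw [inv_div] at this
      convert this using 2
      field_simp
    have hterm : u (t + 1) / (√(w (t + 1)) + ε) ^ 2 ≤
        1 - (ε ^ 2 + w t) / (ε ^ 2 + w (t + 1)) := by
      rw [one_sub_div hpos'.ne', show ε ^ 2 + w (t + 1) - (ε ^ 2 + w t) = u (t + 1) by linarith]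
      refine div_le_div_of_nonneg_left hu' hpos' ?_
      nlinarith [sq_sqrt (show 0 ≤ w (t + 1) by linarith), sqrt_nonneg (w (t + 1))]
    linarith

theorem exp_sub_half_sq_le {z σ : ℝ} (hz : |z| ≤ σ) :
    exp (z - σ ^ 2 / 2) ≤ 1 + exp (-(σ ^ 2 / 2)) * (sinh σ / σ) * z := by
  have hσ : 0 ≤ σ := (abs_nonneg z).trans hz
  rcases hσ.eq_or_lt with rfl | hσ
  · simp [abs_nonpos_iff.1 hz]
  have h : exp z ≤ cosh σ + z / σ * sinh σ := by
    have := Real.exp_mul_le_cosh_add_mul_sinh (t := z / σ)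
      (by rw [abs_div, abs_of_pos hσ]; exact div_le_one_of_le₀ hz hσ.le) σ
    rwa [div_mul_cancel₀ _ hσ.ne'] at this
  have hc : exp (-(σ ^ 2 / 2)) * cosh σ ≤ 1 := by
    calc exp (-(σ ^ 2 / 2)) * cosh σ ≤ exp (-(σ ^ 2 / 2)) * exp (σ ^ 2 / 2) := by
          gcongr; exact cosh_le_exp_half_sq σ
      _ = 1 := by rw [← exp_add]; simp
  calc exp (z - σ ^ 2 / 2) = exp (-(σ ^ 2 / 2)) * exp z := by rw [← exp_add]; ring_nf
    _ ≤ exp (-(σ ^ 2 / 2)) * (cosh σ + z / σ * sinh σ) := by gcongr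
    _ = exp (-(σ ^ 2 / 2)) * cosh σ + exp (-(σ ^ 2 / 2)) * (sinh σ / σ) * z := by ring
    _ ≤ _ := by gcongr

theorem abs_exp_mul_sinh_div_mul_le {z σ K : ℝ} (hz : |z| ≤ σ) (hK : σ ≤ K) :
    |exp (-(σ ^ 2 / 2)) * (sinh σ / σ) * z| ≤ sinh K := by
  have hσ : 0 ≤ σ := (abs_nonneg z).trans hz
  have hs : 0 ≤ sinh σ := sinh_nonneg_iff.2 hσ
  rw [abs_mul, abs_mul, abs_of_pos (exp_pos _), abs_of_nonneg (by positivity)]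
  calc exp (-(σ ^ 2 / 2)) * (sinh σ / σ) * |z| ≤ 1 * (sinh σ / σ) * σ := by
        gcongr
        exact exp_le_one_iff.2 (by simp; positivity)
    _ ≤ sinh σ := by
        rcases hσ.eq_or_lt with rfl | hσ
        · simp
        · rw [one_mul, div_mul_cancel₀ _ hσ.ne']
    _ ≤ sinh K := sinh_le_sinh.2 hK

theorem integral_exp_sum_sub_half_sq_le_one {Ω : Type*} {m0 : MeasurableSpace Ω} {μ : Measure Ω}
    [IsProbabilityMeasure μ] (F : Filtration ℕ m0) {T : ℕ} {Z σ : ℕ → Ω → ℝ} {K : ℝ}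
    (hZ : ∀ s, 1 ≤ s → s ≤ T → Measurable[F s] (Z s))
    (hσ : ∀ s, 1 ≤ s → s ≤ T → Measurable[F (s - 1)] (σ s))
    (hZσ : ∀ s, 1 ≤ s → s ≤ T → ∀ᵐ ω ∂μ, |Z s ω| ≤ σ s ω)
    (hσK : ∀ s, 1 ≤ s → s ≤ T → ∀ ω, σ s ω ≤ K)
    (hmean : ∀ s, 1 ≤ s → s ≤ T → μ[Z s | F (s - 1)] =ᵐ[μ] 0) {t : ℕ} (ht : t ≤ T) :
    Measurable[F t] (fun ω => exp (∑ s ∈ Icc 1 t, (Z s ω - σ s ω ^ 2 / 2))) ∧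
    (∀ᵐ ω ∂μ, exp (∑ s ∈ Icc 1 t, (Z s ω - σ s ω ^ 2 / 2)) ≤ exp (t * K)) ∧
    ∫ ω, exp (∑ s ∈ Icc 1 t, (Z s ω - σ s ω ^ 2 / 2)) ∂μ ≤ 1 := by
  induction t with
  | zero => simp
  | succ t ih =>
    obtain ⟨hM, hMK, hM1⟩ := ih (by omega)
    set M : Ω → ℝ := fun ω => exp (∑ s ∈ Icc 1 t, (Z s ω - σ s ω ^ 2 / 2)) with hMdef
    have hsplit (ω : Ω) : exp (∑ s ∈ Icc 1 (t + 1), (Z s ω - σ s ω ^ 2 / 2)) =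
        M ω * exp (Z (t + 1) ω - σ (t + 1) ω ^ 2 / 2) := by
      rw [sum_Icc_succ_top (by omega), exp_add]
    simp only [hsplit]
    have hZ' := hZ (t + 1) (by omega) ht
    have hσ' : Measurable[F t] (σ (t + 1)) := hσ (t + 1) (by omega) ht
    have hZσ' := hZσ (t + 1) (by omega) ht
    have hσK' := hσK (t + 1) (by omega) ht
    have hmean' : μ[Z (t + 1) | F t] =ᵐ[μ] 0 := hmean (t + 1) (by omega) ht
    have hmeas : Measurable[F (t + 1)]
        (fun ω => M ω * exp (Z (t + 1) ω - σ (t + 1) ω ^ 2 / 2)) := by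
      have h1 : Measurable[F (t + 1)] M := hM.mono (F.mono (by omega)) le_rfl
      have h2 : Measurable[F (t + 1)] (σ (t + 1)) := hσ'.mono (F.mono (by omega)) le_rfl
      fun_prop
    have hbound : ∀ᵐ ω ∂μ, M ω * exp (Z (t + 1) ω - σ (t + 1) ω ^ 2 / 2) ≤
        exp (((t + 1 : ℕ) : ℝ) * K) := by
      filter_upwards [hMK, hZσ'] with ω h1 h2
      have h3 : Z (t + 1) ω - σ (t + 1) ω ^ 2 / 2 ≤ K := by
        linarith [le_abs_self (Z (t + 1) ω), hσK' ω, sq_nonneg (σ (t + 1) ω)]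
      calc M ω * exp (Z (t + 1) ω - σ (t + 1) ω ^ 2 / 2) ≤ exp (t * K) * exp K := by gcongr
        _ = _ := by rw [← exp_add]; push_cast; ring_nf
    refine ⟨hmeas, hbound, ?_⟩
    set h : Ω → ℝ := fun ω =>
      M ω * (exp (-(σ (t + 1) ω ^ 2 / 2)) * (sinh (σ (t + 1) ω) / σ (t + 1) ω)) with hh
    have hh_meas : Measurable[F t] h := by
      have : Measurable[F t] (fun ω => sinh (σ (t + 1) ω)) := measurable_sinh.comp hσ'
      fun_prop
    have hZint : Integrable (Z (t + 1)) μ := by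
      refine Integrable.of_bound ((hZ'.mono (F.le _) le_rfl).aestronglyMeasurable) K ?_
      filter_upwards [hZσ'] with ω h1
      exact h1.trans (hσK' ω)
    have hhZ : Integrable (fun ω => h ω * Z (t + 1) ω) μ := by
      refine Integrable.of_bound
        ((hh_meas.mono (F.le _) le_rfl).mul (hZ'.mono (F.le _) le_rfl)).aestronglyMeasurable
        (exp (t * K) * sinh K) ?_
      filter_upwards [hMK, hZσ'] with ω h1 h2
      rw [hh, Real.norm_eq_abs, mul_assoc, abs_mul, abs_of_pos (exp_pos _)]
      exact mul_le_mul h1 (abs_exp_mul_sinh_div_mul_le h2 (hσK' ω)) (abs_nonneg _)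
        (exp_pos _).le
    have hzero : ∫ ω, h ω * Z (t + 1) ω ∂μ = 0 := by
      rw [← integral_condExp (F.le t)]
      have := condExp_mul_of_stronglyMeasurable_left (μ := μ) hh_meas.stronglyMeasurable hhZ hZint
      refine (integral_congr_ae this).trans ?_
      refine integral_eq_zero_of_ae ?_
      filter_upwards [hmean'] with ω hω
      simp [hω]
    have hMint : Integrable M μ := by
      refine Integrable.of_bound (hM.mono (F.le _) le_rfl).aestronglyMeasurable (exp (t * K)) ?_
      filter_upwards [hMK] with ω h1
      rwa [Real.norm_of_nonneg (exp_pos _).le]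
    calc ∫ ω, M ω * exp (Z (t + 1) ω - σ (t + 1) ω ^ 2 / 2) ∂μ
        ≤ ∫ ω, (M ω + h ω * Z (t + 1) ω) ∂μ := by
          refine integral_mono_ae ?_ (hMint.add hhZ) ?_
          · refine Integrable.of_bound (hmeas.mono (F.le _) le_rfl).aestronglyMeasurable
              (exp (((t + 1 : ℕ) : ℝ) * K)) ?_
            filter_upwards [hbound] with ω h1
            rwa [Real.norm_of_nonneg (by positivity)]
          · filter_upwards [hZσ'] with ω h1
            have h2 := mul_le_mul_of_nonneg_left (exp_sub_half_sq_le h1) (exp_pos _ : 0 < M ω).le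
            rw [hh]
            linarith
      _ = ∫ ω, M ω ∂μ := by rw [integral_add hMint hhZ, hzero, add_zero]
      _ ≤ 1 := hM1

theorem measure_exists_log_lt_sum_sub_half_sq_le {Ω : Type*} {m0 : MeasurableSpace Ω}
    {μ : Measure Ω} [IsProbabilityMeasure μ] (F : Filtration ℕ m0) {T : ℕ} {Z σ : ℕ → Ω → ℝ}
    {K δ : ℝ} (hδ : 0 < δ)
    (hZ : ∀ s, 1 ≤ s → s ≤ T → Measurable[F s] (Z s))
    (hσ : ∀ s, 1 ≤ s → s ≤ T → Measurable[F (s - 1)] (σ s))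
    (hZσ : ∀ s, 1 ≤ s → s ≤ T → ∀ᵐ ω ∂μ, |Z s ω| ≤ σ s ω)
    (hσK : ∀ s, 1 ≤ s → s ≤ T → ∀ ω, σ s ω ≤ K)
    (hmean : ∀ s, 1 ≤ s → s ≤ T → μ[Z s | F (s - 1)] =ᵐ[μ] 0) :
    μ {ω | ∃ t, 1 ≤ t ∧ t ≤ T ∧ log (T / δ) < ∑ s ∈ Icc 1 t, (Z s ω - σ s ω ^ 2 / 2)} ≤
      ENNReal.ofReal δ := by
  rcases Nat.eq_zero_or_pos T with rfl | hT
  · have : {ω | ∃ t, 1 ≤ t ∧ t ≤ 0 ∧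
        log ((0 : ℕ) / δ) < ∑ s ∈ Icc 1 t, (Z s ω - σ s ω ^ 2 / 2)} = ∅ := by
      ext ω
      simp only [Set.mem_ofPred_eq, Set.mem_empty_iff_false, iff_false]
      rintro ⟨t, h1, h2, -⟩
      omega
    rw [this]
    simp
  have hT' : (0 : ℝ) < T := by exact_mod_cast hT
  have hone (t : ℕ) (ht : t ∈ Icc 1 T) :
      μ {ω | log (T / δ) < ∑ s ∈ Icc 1 t, (Z s ω - σ s ω ^ 2 / 2)} ≤ ENNReal.ofReal (δ / T) := by
    obtain ⟨hM, hMK, hM1⟩ := integral_exp_sum_sub_half_sq_le_one F hZ hσ hZσ hσK hmean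
      (mem_Icc.1 ht).2
    have h_int : Integrable (fun ω => exp (∑ s ∈ Icc 1 t, (Z s ω - σ s ω ^ 2 / 2))) μ := by
      refine Integrable.of_bound (hM.mono (F.le _) le_rfl).aestronglyMeasurable (exp (t * K)) ?_
      filter_upwards [hMK] with ω h1
      rwa [Real.norm_of_nonneg (exp_pos _).le]
    have hmarkov := mul_meas_ge_le_integral_of_nonneg (ae_of_all _ fun ω => (exp_pos _).le) h_int
      (T / δ)
    have hle : μ.real {ω | T / δ ≤ exp (∑ s ∈ Icc 1 t, (Z s ω - σ s ω ^ 2 / 2))} ≤ δ / T := by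
      rw [le_div_iff₀ hT', mul_comm]
      have := hmarkov.trans hM1
      rwa [div_mul_eq_mul_div, div_le_one hδ] at this
    refine (measure_mono fun ω hω => ?_).trans
      ((ENNReal.le_ofReal_iff_toReal_le (measure_ne_top _ _) (by positivity)).2 hle)
    exact ((log_lt_iff_lt_exp (by positivity)).1 hω).le
  calc μ {ω | ∃ t, 1 ≤ t ∧ t ≤ T ∧ log (T / δ) < ∑ s ∈ Icc 1 t, (Z s ω - σ s ω ^ 2 / 2)}
      ≤ μ (⋃ t ∈ Icc 1 T, {ω | log (T / δ) < ∑ s ∈ Icc 1 t, (Z s ω - σ s ω ^ 2 / 2)}) := by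
        refine measure_mono ?_
        rintro ω ⟨t, h1, h2, h3⟩
        simp only [Set.mem_iUnion]
        exact ⟨t, mem_Icc.2 ⟨h1, h2⟩, h3⟩
    _ ≤ ∑ t ∈ Icc 1 T, μ {ω | log (T / δ) < ∑ s ∈ Icc 1 t, (Z s ω - σ s ω ^ 2 / 2)} :=
        measure_biUnion_finset_le _ _
    _ ≤ ∑ t ∈ Icc 1 T, ENNReal.ofReal (δ / T) := sum_le_sum hone
    _ = ENNReal.ofReal δ := by
        rw [sum_const, Nat.card_Icc, Nat.add_sub_cancel, nsmul_eq_mul,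
          ← ENNReal.ofReal_natCast, ← ENNReal.ofReal_mul hT'.le, mul_div_cancel₀ _ hT'.ne']

theorem adagrad_budget {r X Δ η D₁ ℓ D c : ℝ} (hX : 0 < X) (hη : 0 < η) (hr : 0 ≤ r)
    (hc : 0 ≤ c) (hD₁ : 0 ≤ D₁) (hℓ : 0 ≤ ℓ) (hD : 0 ≤ D)
    (hΔ : Δ = 4 * D₁ + 12 * r * η * ℓ + 4 * (r * η + c + c) * D + 72 * X * η ^ 2 * ℓ ^ 2 +
      8 * X * η ^ 2 * D ^ 2) :
    D₁ + 3 * √(X * Δ + r ^ 2) * η * ℓ + (η * √(X * Δ + r ^ 2) + c / 2) * D ≤ Δ / 2 := by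
  have hΔ0 : 0 ≤ Δ := by rw [hΔ]; positivity
  set y := √(X * Δ)
  have hy : y ^ 2 = X * Δ := sq_sqrt (by positivity)
  have hy0 : 0 ≤ y := sqrt_nonneg _
  have hG : √(X * Δ + r ^ 2) ≤ y + r := by
    refine sqrt_le_iff.2 ⟨by positivity, ?_⟩
    nlinarith [mul_nonneg hy0 hr]
  have h1 : 24 * η * ℓ * y ≤ Δ + 144 * X * η ^ 2 * ℓ ^ 2 := by
    refine le_of_mul_le_mul_left ?_ hX
    nlinarith [sq_nonneg (y - 12 * X * η * ℓ)]
  have h2 : 8 * η * D * y ≤ Δ + 16 * X * η ^ 2 * D ^ 2 := by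
    refine le_of_mul_le_mul_left ?_ hX
    nlinarith [sq_nonneg (y - 4 * X * η * D)]
  have h3 : √(X * Δ + r ^ 2) * (3 * η * ℓ + η * D) ≤ (y + r) * (3 * η * ℓ + η * D) := by gcongr
  have h4 : 0 ≤ c * D := by positivity
  linarith

theorem le_of_le_mul_sqrt_add {Y P R b K : ℝ} (hY : 0 ≤ Y) (hb : 0 ≤ b) (hK : 0 ≤ K)
    (hP : 0 ≤ P) (h : Y ≤ P * (√(2 * b * Y + K) + R)) :
    Y ≤ 2 * P * (b * P + √K + R) := by
  set y := √(2 * b * Y)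
  have hy : y ^ 2 = 2 * b * Y := sq_sqrt (by positivity)
  have hy0 : 0 ≤ y := sqrt_nonneg _
  have hsub : √(2 * b * Y + K) ≤ y + √K := by
    refine sqrt_le_iff.2 ⟨by positivity, ?_⟩
    nlinarith [mul_nonneg hy0 (sqrt_nonneg K), sq_sqrt hK]
  have h1 : Y ≤ P * (y + √K + R) := h.trans (by gcongr)
  have h2 : P * y ≤ Y / 2 + b * P ^ 2 := by
    rcases hb.eq_or_lt with rfl | hb
    · have : y = 0 := by simp [y]
      rw [this]; linarith
    · refine le_of_mul_le_mul_left ?_ hb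
      nlinarith [sq_nonneg (y - 2 * b * P)]
  linarith

section AdaGrad

variable {d : ℕ} {η ε : ℝ} {g v x : ℕ → EuclideanSpace ℝ (Fin d)}
  {f : EuclideanSpace ℝ (Fin d) → ℝ} {f' : EuclideanSpace ℝ (Fin d) → EuclideanSpace ℝ (Fin d)}

theorem adagrad_accumulator_eq_sum (hv0 : v 0 = 0)
    (hv : ∀ s, 1 ≤ s → ∀ i, v s i = v (s - 1) i + g s i ^ 2) (t : ℕ) (i : Fin d) :
    v t i = ∑ s ∈ Icc 1 t, g s i ^ 2 := by
  induction t with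
  | zero => simp [hv0]
  | succ t ih => rw [sum_Icc_succ_top (by omega), hv (t + 1) (by omega), ← ih]; rfl

theorem adagrad_accumulator_nonneg (hv0 : v 0 = 0)
    (hv : ∀ s, 1 ≤ s → ∀ i, v s i = v (s - 1) i + g s i ^ 2) (t : ℕ) (i : Fin d) :
    0 ≤ v t i := by
  rw [adagrad_accumulator_eq_sum hv0 hv]
  exact sum_nonneg fun s _ => sq_nonneg _

theorem EuclideanSpace.sq_apply_le_norm_sq (p : EuclideanSpace ℝ (Fin d)) (i : Fin d) :
    p i ^ 2 ≤ ‖p‖ ^ 2 := by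
  rw [EuclideanSpace.real_norm_sq_eq]
  exact single_le_sum (f := fun j => p j ^ 2) (fun j _ => sq_nonneg _) (mem_univ i)

theorem adagrad_accumulator_le_sum_norm_sq (hv0 : v 0 = 0)
    (hv : ∀ s, 1 ≤ s → ∀ i, v s i = v (s - 1) i + g s i ^ 2) {t T : ℕ} (ht : t ≤ T) (i : Fin d) :
    v t i ≤ ∑ s ∈ Icc 1 T, ‖g s‖ ^ 2 := by
  rw [adagrad_accumulator_eq_sum hv0 hv]
  calc ∑ s ∈ Icc 1 t, g s i ^ 2 ≤ ∑ s ∈ Icc 1 t, ‖g s‖ ^ 2 :=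
        sum_le_sum fun s _ => EuclideanSpace.sq_apply_le_norm_sq _ _
    _ ≤ _ := sum_le_sum_of_subset_of_nonneg (Icc_subset_Icc_right ht) fun _ _ _ => sq_nonneg _

theorem adagrad_norm_step_sq
    (hx : ∀ s, 1 ≤ s → ∀ i, x (s + 1) i = x s i - η * g s i / (√(v s i) + ε)) {s : ℕ}
    (hs : 1 ≤ s) :
    ‖x (s + 1) - x s‖ ^ 2 = η ^ 2 * ∑ i, g s i ^ 2 / (√(v s i) + ε) ^ 2 := by
  rw [EuclideanSpace.real_norm_sq_eq, mul_sum]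
  refine sum_congr rfl fun i _ => ?_
  rw [PiLp.sub_apply, hx s hs, ← div_pow]
  ring

theorem adagrad_norm_step_le (hη : 0 < η) (hε : 0 < ε) (hv0 : v 0 = 0)
    (hv : ∀ s, 1 ≤ s → ∀ i, v s i = v (s - 1) i + g s i ^ 2)
    (hx : ∀ s, 1 ≤ s → ∀ i, x (s + 1) i = x s i - η * g s i / (√(v s i) + ε)) {s : ℕ}
    (hs : 1 ≤ s) :
    ‖x (s + 1) - x s‖ ≤ η * √d := by
  have hcoord (i : Fin d) : g s i ^ 2 / (√(v s i) + ε) ^ 2 ≤ 1 := by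
    have h0 := adagrad_accumulator_nonneg hv0 hv (s - 1) i
    have h1 := adagrad_accumulator_nonneg hv0 hv s i
    rw [div_le_one (by positivity)]
    nlinarith [hv s hs i, sq_sqrt h1, sqrt_nonneg (v s i)]
  refine le_of_sq_le_sq ?_ (by positivity)
  rw [adagrad_norm_step_sq hx hs, mul_pow, sq_sqrt (Nat.cast_nonneg d)]
  gcongr
  calc ∑ i, g s i ^ 2 / (√(v s i) + ε) ^ 2 ≤ ∑ _i : Fin d, (1 : ℝ) :=
        sum_le_sum fun i _ => hcoord i
    _ = d := by simp

theorem adagrad_norm_sub_le (hη : 0 < η) (hε : 0 < ε) (hv0 : v 0 = 0)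
    (hv : ∀ s, 1 ≤ s → ∀ i, v s i = v (s - 1) i + g s i ^ 2)
    (hx : ∀ s, 1 ≤ s → ∀ i, x (s + 1) i = x s i - η * g s i / (√(v s i) + ε)) {s T : ℕ}
    (hs : 1 ≤ s) (hsT : s ≤ T) :
    ‖x s - x 1‖ ≤ T * (η * √d) := by
  have h : ‖x s - x 1‖ ≤ ((s - 1 : ℕ) : ℝ) * (η * √d) := by
    induction s, hs using Nat.le_induction with
    | base => simp
    | succ s hs ih =>
      have hstep := adagrad_norm_step_le hη hε hv0 hv hx hs
      have := norm_sub_le_norm_sub_add_norm_sub (x (s + 1)) (x s) (x 1)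
      have ih := ih (by omega)
      have hcast : ((s + 1 - 1 : ℕ) : ℝ) = ((s - 1 : ℕ) : ℝ) + 1 := by
        exact_mod_cast (by omega : s + 1 - 1 = s - 1 + 1)
      rw [hcast]
      linarith
  refine h.trans ?_
  gcongr
  omega

theorem adagrad_value_sub_le {L : ℝ} (hη : 0 < η) (hε : 0 < ε) (hL : 0 < L) (hv0 : v 0 = 0)
    (hv : ∀ s, 1 ≤ s → ∀ i, v s i = v (s - 1) i + g s i ^ 2)
    (hx : ∀ s, 1 ≤ s → ∀ i, x (s + 1) i = x s i - η * g s i / (√(v s i) + ε))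
    (hf : ∀ p, HasGradientAt f (f' p) p) (hf' : ∀ p q, ‖f' p - f' q‖ ≤ L * ‖p - q‖) {s T : ℕ}
    (hs : 1 ≤ s) (hsT : s ≤ T) :
    f (x s) ≤ f (x 1) + η * ‖f' (x 1)‖ * √d * T + L * η ^ 2 * d / 2 * T ^ 2 := by
  have h1 := le_add_inner_add_sq_of_lipschitz_gradient hf hf' (x 1) (x s)
  have h2 := adagrad_norm_sub_le hη hε hv0 hv hx hs hsT
  have h3 : inner ℝ (f' (x 1)) (x s - x 1) ≤ ‖f' (x 1)‖ * (T * (η * √d)) :=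
    (real_inner_le_norm _ _).trans (by gcongr)
  have h4 : L / 2 * ‖x s - x 1‖ ^ 2 ≤ L / 2 * (T * (η * √d)) ^ 2 := by gcongr
  have h5 : (T * (η * √d)) ^ 2 = T ^ 2 * (η ^ 2 * d) := by
    rw [mul_pow, mul_pow, sq_sqrt (Nat.cast_nonneg d)]
  rw [h5] at h4
  linarith

theorem norm_sq_le_of_affine_noise {E : Type*} [SeminormedAddCommGroup E] {p q : E} {B C : ℝ}
    (h : ‖p - q‖ ^ 2 ≤ B * ‖q‖ ^ 2 + C) : ‖p‖ ^ 2 ≤ 2 * (B + 1) * ‖q‖ ^ 2 + 2 * C := by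
  have h1 : ‖p‖ ≤ ‖p - q‖ + ‖q‖ := norm_le_norm_sub_add p q
  nlinarith [sq_nonneg (‖p - q‖ - ‖q‖), norm_nonneg p, norm_nonneg q, norm_nonneg (p - q)]

theorem adagrad_proxy_coord_le {G ε h z w : ℝ} (hG : 0 < G) (hε : 0 < ε) (hw : 0 ≤ w)
    (hz : z ^ 2 ≤ G ^ 2) :
    -(h * (z / (√(w + z ^ 2) + ε))) ≤ -(3 / 4) * (h ^ 2 / (√(w + G ^ 2) + ε)) -
      h * (z - h) / (√(w + G ^ 2) + ε) + G * (z ^ 2 / (√(w + z ^ 2) + ε) ^ 2) := by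
  set a := √(w + G ^ 2) + ε with ha
  set b := √(w + z ^ 2) + ε with hb
  have hapos : 0 < a := by positivity
  have hbpos : 0 < b := by positivity
  have hGa : G ≤ a := by
    have : G ≤ √(w + G ^ 2) := le_sqrt_of_sq_le (by linarith)
    linarith
  have hle : b ≤ a := by rw [ha, hb]; gcongr
  have hab : a - b ≤ G := by
    have h1 := sqrt_nonneg (w + z ^ 2)
    have h2 : √(w + G ^ 2) ≤ √(w + z ^ 2) + G := by
      refine sqrt_le_iff.2 ⟨by positivity, ?_⟩
      nlinarith [sq_sqrt (show 0 ≤ w + z ^ 2 by positivity), sq_nonneg z]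
    linarith
  set p := a⁻¹
  set q := b⁻¹
  have hp : 0 < p := inv_pos.2 hapos
  have hq : 0 < q := inv_pos.2 hbpos
  have hpG : p * G ≤ 1 := by
    rw [inv_mul_le_iff₀ hapos]; linarith
  have hpq : q - p = (a - b) * (p * q) := by
    simp only [p, q]
    field_simp
  have hcross : -(h * z) * (q - p) ≤ 1 / 4 * h ^ 2 * p + G * (z ^ 2 * q ^ 2) := by
    have h1 : -(h * z) * (q - p) ≤ |h| * |z| * (G * (p * q)) := by
      rw [hpq, ← abs_mul]
      calc -(h * z) * ((a - b) * (p * q)) ≤ |h * z| * ((a - b) * (p * q)) := by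
            refine mul_le_mul_of_nonneg_right (neg_le_abs _) ?_
            exact mul_nonneg (by linarith) (by positivity)
        _ ≤ _ := by gcongr
    have h2 : 0 ≤ p * (|h| / 2 - |z| * G * q) ^ 2 := by positivity
    have h3 : p * G * (G * (z ^ 2 * q ^ 2)) ≤ 1 * (G * (z ^ 2 * q ^ 2)) := by gcongr
    have h4 : p * (|h| / 2 - |z| * G * q) ^ 2 = 1 / 4 * h ^ 2 * p - |h| * |z| * (G * (p * q)) +
        p * G * (G * (z ^ 2 * q ^ 2)) := by
      rw [← sq_abs h, ← sq_abs z]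
      ring
    linarith
  rw [div_eq_mul_inv z b, div_eq_mul_inv (h ^ 2) a, div_eq_mul_inv (h * (z - h)) a,
    div_eq_mul_inv (z ^ 2) (b ^ 2), ← inv_pow]
  change -(h * (z * q)) ≤ -(3 / 4) * (h ^ 2 * p) - h * (z - h) * p + G * (z ^ 2 * q ^ 2)
  linarith

theorem adagrad_descent {L G : ℝ} (hη : 0 < η) (hε : 0 < ε) (hG : 0 < G) (hv0 : v 0 = 0)
    (hv : ∀ s, 1 ≤ s → ∀ i, v s i = v (s - 1) i + g s i ^ 2)
    (hx : ∀ s, 1 ≤ s → ∀ i, x (s + 1) i = x s i - η * g s i / (√(v s i) + ε))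
    (hf : ∀ p, HasGradientAt f (f' p) p) (hf' : ∀ p q, ‖f' p - f' q‖ ≤ L * ‖p - q‖) {s : ℕ}
    (hs : 1 ≤ s) (hgG : ‖g s‖ ^ 2 ≤ G ^ 2) :
    f (x (s + 1)) ≤ f (x s)
      - 3 / 4 * η * ∑ i, f' (x s) i ^ 2 / (√(v (s - 1) i + G ^ 2) + ε)
      - η * ∑ i, f' (x s) i * (g s i - f' (x s) i) / (√(v (s - 1) i + G ^ 2) + ε)
      + (η * G + L * η ^ 2 / 2) * ∑ i, g s i ^ 2 / (√(v s i) + ε) ^ 2 := by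
  have h1 := le_add_inner_add_sq_of_lipschitz_gradient hf hf' (x s) (x (s + 1))
  rw [adagrad_norm_step_sq hx hs] at h1
  have h2 : inner ℝ (f' (x s)) (x (s + 1) - x s) =
      η * ∑ i, -(f' (x s) i * (g s i / (√(v s i) + ε))) := by
    rw [PiLp.inner_apply, mul_sum]
    refine sum_congr rfl fun i _ => ?_
    rw [PiLp.sub_apply, hx s hs]
    simp
    ring
  have h3 : ∑ i, -(f' (x s) i * (g s i / (√(v s i) + ε))) ≤
      -(3 / 4) * ∑ i, f' (x s) i ^ 2 / (√(v (s - 1) i + G ^ 2) + ε)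
      - ∑ i, f' (x s) i * (g s i - f' (x s) i) / (√(v (s - 1) i + G ^ 2) + ε)
      + G * ∑ i, g s i ^ 2 / (√(v s i) + ε) ^ 2 := by
    rw [mul_sum, mul_sum, ← sum_sub_distrib, ← sum_add_distrib]
    refine sum_le_sum fun i _ => ?_
    rw [hv s hs i]
    exact adagrad_proxy_coord_le hG hε (adagrad_accumulator_nonneg hv0 hv _ i)
      ((EuclideanSpace.sq_apply_le_norm_sq _ i).trans hgG)
  have h4 := mul_le_mul_of_nonneg_left h3 hη.le
  rw [h2] at h1
  linarith

theorem adagrad_sum_normalized_le {Λ : ℝ} (hε : 0 < ε) (hv0 : v 0 = 0)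
    (hv : ∀ s, 1 ≤ s → ∀ i, v s i = v (s - 1) i + g s i ^ 2) {t T : ℕ} (ht : t ≤ T)
    (hΛ : 1 + 1 / ε ^ 2 * ∑ s ∈ Icc 1 T, ‖g s‖ ^ 2 ≤ Λ) :
    ∑ s ∈ Icc 1 t, ∑ i, g s i ^ 2 / (√(v s i) + ε) ^ 2 ≤ d * log Λ := by
  rw [sum_comm]
  calc ∑ i, ∑ s ∈ Icc 1 t, g s i ^ 2 / (√(v s i) + ε) ^ 2 ≤ ∑ _i : Fin d, log Λ := by
        refine sum_le_sum fun i _ => ?_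
        have hi := sum_div_sq_sqrt_add_le_log (u := fun s => g s i ^ 2) (w := fun s => v s i) hε
          (by simp [hv0]) (fun s => sq_nonneg _) (fun s hs => hv s hs i) t
        refine hi.2.trans (log_le_log (by have := hi.1; positivity) (le_trans ?_ hΛ))
        rw [div_eq_inv_mul, one_div]
        gcongr
        exact adagrad_accumulator_le_sum_norm_sq hv0 hv ht i
    _ = d * log Λ := by simp

theorem adagrad_sum_norm_gradient_sq_le {L m B C X Λ Δ G δ : ℝ} {T : ℕ}
    (hη : 0 < η) (hε : 0 < ε) (hL : 0 < L) (hB : 0 < B) (hC : 0 < C) (hT : 1 ≤ T)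
    (hδ0 : 0 < δ) (hδ1 : δ < 1) (hv0 : v 0 = 0)
    (hv : ∀ s, 1 ≤ s → ∀ i, v s i = v (s - 1) i + g s i ^ 2)
    (hx : ∀ s, 1 ≤ s → ∀ i, x (s + 1) i = x s i - η * g s i / (√(v s i) + ε))
    (hf : ∀ p, HasGradientAt f (f' p) p) (hf' : ∀ p q, ‖f' p - f' q‖ ≤ L * ‖p - q‖)
    (hm : ∀ p, m ≤ f p)
    (hnoise : ∀ s, 1 ≤ s → s ≤ T → ‖g s - f' (x s)‖ ^ 2 ≤ B * ‖f' (x s)‖ ^ 2 + C)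
    (hX : X = 4 * L * B + 4 * L)
    (hΛ : Λ = 1 + 1 / ε ^ 2 *
      ((X * (f (x 1) - m) + 2 * C) * (T : ℝ) +
        (η * ‖f' (x 1)‖ * √(d : ℝ) + L * η ^ 2 * (d : ℝ) / 2) * X * (T : ℝ) ^ 2 +
        L * η ^ 2 * (d : ℝ) * X * (T : ℝ) ^ 3))
    (hΔ : Δ = 4 * (f (x 1) - m) +
      12 * √(2 * C) * η * log ((T : ℝ) / δ) +
      4 * (√(2 * C) * η + L * η ^ 2 + L * η ^ 2) * (d : ℝ) * log Λ +
      72 * X * η ^ 2 * log ((T : ℝ) / δ) ^ 2 +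
      8 * X * η ^ 2 * (d : ℝ) ^ 2 * log Λ ^ 2)
    (hG : G = √(X * Δ + 2 * C))
    (hconc : ∀ t, 1 ≤ t → t ≤ T → (∀ s, 1 ≤ s → s ≤ t → f (x s) - m ≤ Δ) →
      -∑ s ∈ Icc 1 t, ∑ i,
          f' (x s) i * (g s i - f' (x s) i) / (√(v (s - 1) i + G ^ 2) + ε) ≤
        3 * G * log (T / δ) +
          1 / 6 * ∑ s ∈ Icc 1 t, ∑ i, f' (x s) i ^ 2 / (√(v (s - 1) i + G ^ 2) + ε)) :
    ∑ s ∈ Icc 1 T, ‖f' (x s)‖ ^ 2 ≤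
      2 * (Δ / η) * ((B + 1) * (Δ / η) + √(2 * C * T) + (G + ε)) := by
  have hX0 : 0 < X := by rw [hX]; positivity
  have hT' : (1 : ℝ) ≤ T := by exact_mod_cast hT
  have hD₁ : 0 ≤ f (x 1) - m := sub_nonneg.2 (hm _)
  have hℓ : 0 ≤ log (T / δ) := log_nonneg (by rw [le_div_iff₀ hδ0]; linarith)
  have hΛ1 : 1 ≤ Λ := by
    rw [hΛ, le_add_iff_nonneg_right]
    positivity
  have hlogΛ : 0 ≤ log Λ := log_nonneg hΛ1
  have hΔ0 : 0 ≤ Δ := by rw [hΔ]; positivity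
  have hGsq : G ^ 2 = X * Δ + 2 * C := by rw [hG, sq_sqrt (by positivity)]
  have hG0 : 0 < G := by rw [hG]; positivity
  have hgX (s : ℕ) (hs : 1 ≤ s) (hsT : s ≤ T) : ‖g s‖ ^ 2 ≤ X * (f (x s) - m) + 2 * C := by
    have h1 := norm_sq_le_of_affine_noise (hnoise s hs hsT)
    have h2 := mul_le_mul_of_nonneg_left (norm_gradient_sq_le hL hf hf' hm (x s))
      (by positivity : 0 ≤ 2 * (B + 1))
    rw [hX]
    linarith
  have hsumg : 1 + 1 / ε ^ 2 * ∑ s ∈ Icc 1 T, ‖g s‖ ^ 2 ≤ Λ := by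
    rw [hΛ]
    gcongr
    have hterm (s : ℕ) (hs : s ∈ Icc 1 T) : ‖g s‖ ^ 2 ≤
        X * (f (x 1) - m + η * ‖f' (x 1)‖ * √d * T + L * η ^ 2 * d / 2 * T ^ 2) + 2 * C := by
      rw [mem_Icc] at hs
      refine (hgX s hs.1 hs.2).trans ?_
      have := adagrad_value_sub_le hη hε hL hv0 hv hx hf hf' hs.1 hs.2
      gcongr
      linarith
    refine (sum_le_sum hterm).trans ?_
    rw [sum_const, Nat.card_Icc, Nat.add_sub_cancel, nsmul_eq_mul]
    have h1 : 0 ≤ L * η ^ 2 * d / 2 * X * T ^ 2 := by positivity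
    have h2 : 0 ≤ L * η ^ 2 * d * X * T ^ 3 := by positivity
    linarith
  set A : ℕ → ℝ := fun s => ∑ i, f' (x s) i ^ 2 / (√(v (s - 1) i + G ^ 2) + ε) with hA
  set N : ℕ → ℝ := fun s =>
    ∑ i, f' (x s) i * (g s i - f' (x s) i) / (√(v (s - 1) i + G ^ 2) + ε) with hN
  set Q : ℕ → ℝ := fun s => ∑ i, g s i ^ 2 / (√(v s i) + ε) ^ 2 with hQ
  have hA0 (s : ℕ) : 0 ≤ A s := sum_nonneg fun i _ => by positivity
  have htele (t : ℕ) (ht : t ≤ T) (hgood : ∀ s, 1 ≤ s → s ≤ t → f (x s) - m ≤ Δ) :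
      f (x (t + 1)) ≤ f (x 1) - 3 / 4 * η * ∑ s ∈ Icc 1 t, A s - η * ∑ s ∈ Icc 1 t, N s +
        (η * G + L * η ^ 2 / 2) * ∑ s ∈ Icc 1 t, Q s := by
    induction t with
    | zero => simp
    | succ t ih =>
      have ih := ih (by omega) fun s hs hst => hgood s hs (by omega)
      have hgG : ‖g (t + 1)‖ ^ 2 ≤ G ^ 2 := by
        rw [hGsq]
        refine (hgX (t + 1) (by omega) ht).trans ?_
        have := hgood (t + 1) (by omega) le_rfl
        gcongr
      have hstep := adagrad_descent hη hε hG0 hv0 hv hx hf hf' (s := t + 1) (by omega) hgG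
      change _ ≤ _ - 3 / 4 * η * A (t + 1) - η * N (t + 1) + _ * Q (t + 1) at hstep
      rw [sum_Icc_succ_top (by omega), sum_Icc_succ_top (by omega), sum_Icc_succ_top (by omega)]
      linarith
  have hbudget := adagrad_budget hX0 hη (sqrt_nonneg (2 * C))
    (by positivity : 0 ≤ L * η ^ 2) hD₁ hℓ (by positivity : 0 ≤ d * log Λ) (Δ := Δ)
    (by rw [hΔ]; ring)
  rw [sq_sqrt (by positivity), ← hG] at hbudget
  have hmain (t : ℕ) (ht1 : 1 ≤ t) (ht : t ≤ T)
      (hgood : ∀ s, 1 ≤ s → s ≤ t → f (x s) - m ≤ Δ) :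
      f (x (t + 1)) - m + η / 2 * ∑ s ∈ Icc 1 t, A s ≤ Δ / 2 := by
    have h1 := htele t ht hgood
    have h2 := mul_le_mul_of_nonneg_left (hconc t ht1 ht hgood) hη.le
    have h3 := mul_le_mul_of_nonneg_left (adagrad_sum_normalized_le hε hv0 hv ht hsumg)
      (by positivity : 0 ≤ η * G + L * η ^ 2 / 2)
    have h4 : 0 ≤ η * ∑ s ∈ Icc 1 t, A s := mul_nonneg hη.le (sum_nonneg fun s _ => hA0 s)
    linarith
  have hgood (t : ℕ) (ht : t ≤ T) : ∀ s, 1 ≤ s → s ≤ t → f (x s) - m ≤ Δ := by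
    induction t with
    | zero => intro s hs hs'; omega
    | succ t ih =>
      intro s hs hst
      rcases Nat.lt_or_ge s (t + 1) with h | h
      · exact ih (by omega) s hs (by omega)
      obtain rfl : s = t + 1 := by omega
      rcases Nat.eq_zero_or_pos t with rfl | ht0
      · have h1 : 0 ≤ 3 * G * η * log (T / δ) := by positivity
        have h2 : 0 ≤ (η * G + L * η ^ 2 / 2) * (d * log Λ) := by positivity
        simp only [zero_add]
        linarith
      · have h1 := hmain t ht0 (by omega) (ih (by omega))
        have h2 : 0 ≤ η / 2 * ∑ s ∈ Icc 1 t, A s :=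
          mul_nonneg (by positivity) (sum_nonneg fun s _ => hA0 s)
        linarith
  have hsumA : ∑ s ∈ Icc 1 T, A s ≤ Δ / η := by
    rw [le_div_iff₀ hη]
    have h1 := hmain T hT le_rfl (hgood T le_rfl)
    have h2 := hm (x (T + 1))
    linarith
  set Y := ∑ s ∈ Icc 1 T, ‖f' (x s)‖ ^ 2 with hY
  have hY0 : 0 ≤ Y := sum_nonneg fun s _ => sq_nonneg _
  have hgY : ∑ s ∈ Icc 1 T, ‖g s‖ ^ 2 ≤ 2 * (B + 1) * Y + 2 * C * T := by
    calc ∑ s ∈ Icc 1 T, ‖g s‖ ^ 2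
        ≤ ∑ s ∈ Icc 1 T, (2 * (B + 1) * ‖f' (x s)‖ ^ 2 + 2 * C) := by
          refine sum_le_sum fun s hs => ?_
          rw [mem_Icc] at hs
          exact norm_sq_le_of_affine_noise (hnoise s hs.1 hs.2)
      _ = _ := by
          rw [sum_add_distrib, ← mul_sum, sum_const, Nat.card_Icc, Nat.add_sub_cancel,
            nsmul_eq_mul]
          ring
  set R := √(2 * (B + 1) * Y + 2 * C * T) + (G + ε) with hR
  have hAR (s : ℕ) (hs : s ∈ Icc 1 T) : ‖f' (x s)‖ ^ 2 ≤ A s * R := by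
    rw [EuclideanSpace.real_norm_sq_eq, hA, sum_mul]
    refine sum_le_sum fun i _ => ?_
    have hpos : 0 < √(v (s - 1) i + G ^ 2) + ε := by positivity
    have hle : √(v (s - 1) i + G ^ 2) + ε ≤ R := by
      have h1 : v (s - 1) i ≤ 2 * (B + 1) * Y + 2 * C * T :=
        (adagrad_accumulator_le_sum_norm_sq hv0 hv (by rw [mem_Icc] at hs; omega) i).trans hgY
      have h2 : √(v (s - 1) i + G ^ 2) ≤ √(2 * (B + 1) * Y + 2 * C * T) + G := by
        refine sqrt_le_iff.2 ⟨by positivity, ?_⟩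
        nlinarith [sq_sqrt (show 0 ≤ 2 * (B + 1) * Y + 2 * C * T by positivity),
          mul_nonneg (sqrt_nonneg (2 * (B + 1) * Y + 2 * C * T)) hG0.le]
      linarith
    rw [div_mul_eq_mul_div, le_div_iff₀ hpos]
    gcongr
  have hYR : Y ≤ Δ / η * R := by
    calc Y ≤ ∑ s ∈ Icc 1 T, A s * R := sum_le_sum hAR
      _ = (∑ s ∈ Icc 1 T, A s) * R := by rw [sum_mul]
      _ ≤ Δ / η * R := by gcongr
  exact le_of_le_mul_sqrt_add hY0 (by positivity) (by positivity) (by positivity) hYR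

end AdaGrad

section TruncatedWeight

variable {d : ℕ} {f : EuclideanSpace ℝ (Fin d) → ℝ}
  {f' : EuclideanSpace ℝ (Fin d) → EuclideanSpace ℝ (Fin d)}

/-- The predictable direction against which the gradient noise is tested: the gradient at `p`
preconditioned by the proxy step size `(√(v + G²) + ε)⁻¹`, set to zero once the suboptimality
gap `f p - m` exceeds `Δ`. -/
noncomputable def truncatedWeight (f : EuclideanSpace ℝ (Fin d) → ℝ)
    (f' : EuclideanSpace ℝ (Fin d) → EuclideanSpace ℝ (Fin d)) (m Δ G ε : ℝ)
    (v p : EuclideanSpace ℝ (Fin d)) : EuclideanSpace ℝ (Fin d) :=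
  if f p - m ≤ Δ then
    WithLp.toLp 2 fun i => -(1 / (3 * G)) * (f' p i / (√(v i + G ^ 2) + ε))
  else 0

theorem inner_truncatedWeight {m Δ G ε : ℝ} {v p : EuclideanSpace ℝ (Fin d)}
    (hp : f p - m ≤ Δ) (q : EuclideanSpace ℝ (Fin d)) :
    inner ℝ (truncatedWeight f f' m Δ G ε v p) (q - f' p) =
      -(1 / (3 * G)) * ∑ i, f' p i * (q i - f' p i) / (√(v i + G ^ 2) + ε) := by
  rw [truncatedWeight, if_pos hp, PiLp.inner_apply, mul_sum]
  refine sum_congr rfl fun i _ => ?_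
  simp
  ring

theorem sq_mul_norm_truncatedWeight_le {m Δ G ε : ℝ} {v p : EuclideanSpace ℝ (Fin d)}
    (hG : 0 < G) (hε : 0 < ε) (hv : ∀ i, 0 ≤ v i) (hp : f p - m ≤ Δ) :
    (G * ‖truncatedWeight f f' m Δ G ε v p‖) ^ 2 ≤
      1 / (9 * G) * ∑ i, f' p i ^ 2 / (√(v i + G ^ 2) + ε) := by
  rw [truncatedWeight, if_pos hp, mul_pow, EuclideanSpace.real_norm_sq_eq, mul_sum, mul_sum]
  refine sum_le_sum fun i _ => ?_
  have hGa : G ≤ √(v i + G ^ 2) + ε := by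
    have : G ≤ √(v i + G ^ 2) := le_sqrt_of_sq_le (by linarith [hv i])
    linarith
  set a := √(v i + G ^ 2) + ε
  have ha : 0 < a := hG.trans_le hGa
  have hlhs : G ^ 2 * (-(1 / (3 * G)) * (f' p i / a)) ^ 2 =
      1 / 9 * (f' p i ^ 2 / a) * (1 / a) := by
    field_simp
    ring
  have hrhs : 1 / (9 * G) * (f' p i ^ 2 / a) = 1 / 9 * (f' p i ^ 2 / a) * (1 / G) := by
    field_simp
  change G ^ 2 * (-(1 / (3 * G)) * (f' p i / a)) ^ 2 ≤ _
  rw [hlhs, hrhs]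
  gcongr

theorem mul_norm_truncatedWeight_le_one {m Δ G ε : ℝ} {v p : EuclideanSpace ℝ (Fin d)}
    (hG : 0 < G) (hε : 0 < ε) (hv : ∀ i, 0 ≤ v i)
    (hf' : f p - m ≤ Δ → ‖f' p‖ ^ 2 ≤ G ^ 2) :
    G * ‖truncatedWeight f f' m Δ G ε v p‖ ≤ 1 := by
  by_cases hp : f p - m ≤ Δ
  · refine le_of_sq_le_sq ?_ zero_le_one
    refine (sq_mul_norm_truncatedWeight_le hG hε hv hp).trans ?_
    have h : ∑ i, f' p i ^ 2 / (√(v i + G ^ 2) + ε) ≤ G := by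
      calc ∑ i, f' p i ^ 2 / (√(v i + G ^ 2) + ε) ≤ ∑ i, f' p i ^ 2 / G := by
            refine sum_le_sum fun i _ => ?_
            have : G ≤ √(v i + G ^ 2) := le_sqrt_of_sq_le (by linarith [hv i])
            gcongr
            linarith
        _ = ‖f' p‖ ^ 2 / G := by rw [← sum_div, EuclideanSpace.real_norm_sq_eq]
        _ ≤ G := by
            rw [div_le_iff₀ hG]
            nlinarith [hf' hp]
    calc 1 / (9 * G) * ∑ i, f' p i ^ 2 / (√(v i + G ^ 2) + ε) ≤ 1 / (9 * G) * G := by gcongr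
      _ = 1 / 9 := by field_simp
      _ ≤ 1 ^ 2 := by norm_num
  · simp [truncatedWeight, hp]

theorem abs_inner_truncatedWeight_le {m Δ G ε : ℝ} {v p q : EuclideanSpace ℝ (Fin d)}
    (hG : 0 < G) (hq : f p - m ≤ Δ → ‖q - f' p‖ ^ 2 ≤ G ^ 2) :
    |inner ℝ (truncatedWeight f f' m Δ G ε v p) (q - f' p)| ≤
      G * ‖truncatedWeight f f' m Δ G ε v p‖ := by
  by_cases hp : f p - m ≤ Δ
  · rw [mul_comm]
    refine (abs_real_inner_le_norm _ _).trans ?_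
    gcongr
    exact le_of_sq_le_sq (hq hp) hG.le
  · simp [truncatedWeight, hp]

theorem Measurable.truncatedWeight {Ω : Type*} {mΩ : MeasurableSpace Ω} {m Δ G ε : ℝ}
    {v p : Ω → EuclideanSpace ℝ (Fin d)} (hf : Measurable f) (hf' : Measurable f')
    (hv : Measurable v) (hp : Measurable p) :
    Measurable fun ω => truncatedWeight f f' m Δ G ε (v ω) (p ω) := by
  unfold _root_.truncatedWeight
  refine Measurable.ite (measurableSet_le (by fun_prop) measurable_const) ?_ measurable_const
  refine (WithLp.measurable_toLp 2 _).comp (measurable_pi_lambda _ fun i => ?_)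
  have h1 : Measurable fun ω => f' (p ω) i :=
    (EuclideanSpace.proj i).continuous.measurable.comp (hf'.comp hp)
  have h2 : Measurable fun ω => v ω i :=
    (EuclideanSpace.proj i).continuous.measurable.comp hv
  fun_prop

end TruncatedWeight

theorem EuclideanSpace.measurable_of_apply {d : ℕ} {Ω : Type*} {mΩ : MeasurableSpace Ω}
    {u : Ω → EuclideanSpace ℝ (Fin d)} (hu : ∀ i, Measurable fun ω => u ω i) : Measurable u :=
  (WithLp.measurable_toLp 2 _).comp (measurable_pi_lambda (fun ω i => u ω i) hu)

theorem EuclideanSpace.measurable_apply {d : ℕ} {Ω : Type*} {mΩ : MeasurableSpace Ω}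
    {u : Ω → EuclideanSpace ℝ (Fin d)} (hu : Measurable u) (i : Fin d) :
    Measurable fun ω => u ω i :=
  (EuclideanSpace.proj i).continuous.measurable.comp hu

section AdaGradMeasurability

variable {Ω : Type*} {m0 : MeasurableSpace Ω} {F : Filtration ℕ m0} {d T : ℕ} {η ε : ℝ}
  {g v x : ℕ → Ω → EuclideanSpace ℝ (Fin d)}

theorem adagrad_measurable_accumulator (hv0 : ∀ ω, v 0 ω = 0)
    (hv : ∀ s, 1 ≤ s → ∀ ω i, v s ω i = v (s - 1) ω i + g s ω i ^ 2)
    (hg : ∀ s, 1 ≤ s → s ≤ T → Measurable[F s] (g s)) {t : ℕ} (ht : t ≤ T) :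
    Measurable[F t] (v t) := by
  induction t with
  | zero => simp [funext hv0]
  | succ t ih =>
    refine EuclideanSpace.measurable_of_apply fun i => ?_
    simp only [hv (t + 1) (by omega)]
    have h1 : Measurable[F (t + 1)] (v t) := (ih (by omega)).mono (F.mono (by omega)) le_rfl
    exact (EuclideanSpace.measurable_apply h1 i).add
      ((EuclideanSpace.measurable_apply (hg (t + 1) (by omega) ht) i).pow_const 2)

theorem adagrad_measurable_iterate {x1 : EuclideanSpace ℝ (Fin d)} (hx1 : ∀ ω, x 1 ω = x1)
    (hv0 : ∀ ω, v 0 ω = 0)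
    (hv : ∀ s, 1 ≤ s → ∀ ω i, v s ω i = v (s - 1) ω i + g s ω i ^ 2)
    (hx : ∀ s, 1 ≤ s → ∀ ω i, x (s + 1) ω i = x s ω i - η * g s ω i / (√(v s ω i) + ε))
    (hg : ∀ s, 1 ≤ s → s ≤ T → Measurable[F s] (g s)) {s : ℕ} (hs : 1 ≤ s) (hsT : s ≤ T) :
    Measurable[F (s - 1)] (x s) := by
  induction s, hs using Nat.le_induction with
  | base => simp [funext hx1]
  | succ s hs ih =>
    rw [Nat.add_sub_cancel]
    refine EuclideanSpace.measurable_of_apply fun i => ?_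
    simp only [hx s hs]
    have h1 : Measurable[F s] (x s) := (ih (by omega)).mono (F.mono (by omega)) le_rfl
    have h2 : Measurable[F s] (v s) := adagrad_measurable_accumulator hv0 hv hg (by omega)
    exact (EuclideanSpace.measurable_apply h1 i).sub
      (((EuclideanSpace.measurable_apply (hg s hs (by omega)) i).const_mul η).div
        ((EuclideanSpace.measurable_apply h2 i).sqrt.add_const ε))

end AdaGradMeasurability

theorem condExp_inner_sub_eq_zero {Ω E : Type*} {m m0 : MeasurableSpace Ω} {μ : Measure Ω}
    [IsProbabilityMeasure μ] [NormedAddCommGroup E] [InnerProductSpace ℝ E] [CompleteSpace E]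
    (hm : m ≤ m0) {w u z : Ω → E} (hw : StronglyMeasurable[m] w) (hu : StronglyMeasurable[m] u)
    (hz : Integrable z μ) (hu_int : Integrable u μ) (hzu : μ[z | m] =ᵐ[μ] u)
    (h_int : Integrable (fun ω => (inner ℝ (w ω) (z ω - u ω) : ℝ)) μ) :
    μ[fun ω => (inner ℝ (w ω) (z ω - u ω) : ℝ) | m] =ᵐ[μ] 0 := by
  have h1 := condExp_bilin_of_stronglyMeasurable_left (μ := μ) (innerSL ℝ) hw
    (g := z - u) h_int (hz.sub hu_int)
  refine h1.trans ?_
  filter_upwards [condExp_sub hz hu_int m, hzu] with ω h2 h3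
  rw [h2, Pi.sub_apply, h3, condExp_of_stronglyMeasurable hm hu hu_int]
  simp

theorem stmt_1
    {Ω : Type*} {m0 : MeasurableSpace Ω} {μ : Measure Ω} [IsProbabilityMeasure μ]
    (F : Filtration ℕ m0)
    {d : ℕ} (η ε : ℝ) (hη : 0 < η) (hε : 0 < ε)
    (T : ℕ) (hT : 1 ≤ T) (δ : ℝ) (hδ0 : 0 < δ) (hδ1 : δ < 1)
    (g v x : ℕ → Ω → EuclideanSpace ℝ (Fin d))
    (x1 : EuclideanSpace ℝ (Fin d)) (hx1 : ∀ ω, x 1 ω = x1)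
    (hv0 : ∀ ω, v 0 ω = 0)
    (hv : ∀ s, 1 ≤ s → ∀ ω i, v s ω i = v (s - 1) ω i + g s ω i ^ 2)
    (hxrec : ∀ s, 1 ≤ s → ∀ ω i,
      x (s + 1) ω i = x s ω i - η * g s ω i / (Real.sqrt (v s ω i) + ε))
    (f : EuclideanSpace ℝ (Fin d) → ℝ) (fgrad : EuclideanSpace ℝ (Fin d) → EuclideanSpace ℝ (Fin d))
    (hgrad : ∀ p, HasGradientAt f (fgrad p) p)
    (L : ℝ) (hL : 0 < L)
    (hsmooth : ∀ p q, ‖fgrad p - fgrad q‖ ≤ L * ‖p - q‖)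
    (fstar : ℝ) (hfstar : ∀ p, fstar ≤ f p)
    (B C : ℝ) (hB : 0 < B) (hC : 0 < C)
    (hmeas : ∀ s, 1 ≤ s → s ≤ T → Measurable[F s] (g s))
    (hA2 : ∀ s, 1 ≤ s → s ≤ T → μ[g s | F (s - 1)] =ᵐ[μ] fun ω => fgrad (x s ω))
    (hA3 : ∀ s, 1 ≤ s → s ≤ T → ∀ᵐ ω ∂μ,
      ‖g s ω - fgrad (x s ω)‖ ^ 2 ≤ B * ‖fgrad (x s ω)‖ ^ 2 + C)
    (X Ltil FT Δ G Δ₁ B₁ : ℝ)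
    (hX : X = 4 * L * B + 4 * L)
    (hLtil : Ltil = L * η ^ 2)
    (hFT : FT = 1 + 1 / ε ^ 2 *
      ((X * (f x1 - fstar) + 2 * C) * (T : ℝ) +
        (η * ‖fgrad x1‖ * Real.sqrt (d : ℝ) + L * η ^ 2 * (d : ℝ) / 2) * X * (T : ℝ) ^ 2 +
        L * η ^ 2 * (d : ℝ) * X * (T : ℝ) ^ 3))
    (hΔ : Δ = 4 * (f x1 - fstar) +
      12 * Real.sqrt (2 * C) * η * Real.log ((T : ℝ) / δ) +
      4 * (Real.sqrt (2 * C) * η + L * η ^ 2 + Ltil) * (d : ℝ) * Real.log FT +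
      72 * X * η ^ 2 * Real.log ((T : ℝ) / δ) ^ 2 +
      8 * X * η ^ 2 * (d : ℝ) ^ 2 * Real.log FT ^ 2)
    (hG : G = Real.sqrt (X * Δ + 2 * C))
    (hΔ₁ : Δ₁ = Δ / η)
    (hB₁ : B₁ = B + 1) :
    ENNReal.ofReal (1 - δ) ≤
      μ {ω | 1 / (T : ℝ) * ∑ s ∈ Finset.Icc 1 T, ‖fgrad (x s ω)‖ ^ 2 ≤
        2 * Δ₁ * ((B₁ * Δ₁ + G + ε) / (T : ℝ) + Real.sqrt (2 * C / (T : ℝ)))} := by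
  subst hLtil hB₁ hΔ₁
  have hT' : (1 : ℝ) ≤ T := by exact_mod_cast hT
  have hX0 : 0 < X := by rw [hX]; positivity
  have hD₁ : 0 ≤ f x1 - fstar := sub_nonneg.2 (hfstar _)
  have hℓ : 0 ≤ log (T / δ) := log_nonneg (by rw [le_div_iff₀ hδ0]; linarith)
  have hlogFT : 0 ≤ log FT := by
    refine log_nonneg ?_
    rw [hFT, le_add_iff_nonneg_right]
    positivity
  have hΔ0 : 0 ≤ Δ := by rw [hΔ]; positivity
  have hGsq : G ^ 2 = X * Δ + 2 * C := by rw [hG, sq_sqrt (by positivity)]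
  have hG0 : 0 < G := by rw [hG]; positivity
  have hgradG (p : EuclideanSpace ℝ (Fin d)) (hp : f p - fstar ≤ Δ) :
      ‖fgrad p‖ ^ 2 ≤ 2 * L * Δ := by
    refine (norm_gradient_sq_le hL hgrad hsmooth hfstar p).trans ?_
    gcongr
  have hf_cont : Continuous f :=
    continuous_iff_continuousAt.2 fun p => (hgrad p).hasFDerivAt.continuousAt
  have hf'_cont : Continuous fgrad :=
    (LipschitzWith.of_dist_le_mul (K := ⟨L, hL.le⟩)
      fun p q => by rw [dist_eq_norm, dist_eq_norm]; exact hsmooth p q).continuous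
  have hxm (s : ℕ) (hs : 1 ≤ s) (hsT : s ≤ T) : Measurable[F (s - 1)] (x s) :=
    adagrad_measurable_iterate hx1 hv0 hv hxrec hmeas hs hsT
  have hvm (s : ℕ) (hsT : s ≤ T) : Measurable[F s] (v s) :=
    adagrad_measurable_accumulator hv0 hv hmeas hsT
  have hv_nonneg (s : ℕ) (ω : Ω) (i : Fin d) : 0 ≤ v s ω i :=
    adagrad_accumulator_nonneg (v := fun s => v s ω) (g := fun s => g s ω) (hv0 ω)
      (fun s hs => hv s hs ω) s i
  set W : ℕ → Ω → EuclideanSpace ℝ (Fin d) := fun s ω =>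
    truncatedWeight f fgrad fstar Δ G ε (v (s - 1) ω) (x s ω) with hW
  set Z : ℕ → Ω → ℝ := fun s ω => inner ℝ (W s ω) (g s ω - fgrad (x s ω)) with hZ
  set σ : ℕ → Ω → ℝ := fun s ω => G * ‖W s ω‖ with hσ
  have hWm (s : ℕ) (hs : 1 ≤ s) (hsT : s ≤ T) : Measurable[F (s - 1)] (W s) :=
    Measurable.truncatedWeight hf_cont.measurable hf'_cont.measurable (hvm (s - 1) (by omega))
      (hxm s hs hsT)
  have hf'm (s : ℕ) (hs : 1 ≤ s) (hsT : s ≤ T) :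
      Measurable[F (s - 1)] fun ω => fgrad (x s ω) :=
    hf'_cont.measurable.comp (hxm s hs hsT)
  have hZm (s : ℕ) (hs : 1 ≤ s) (hsT : s ≤ T) : Measurable[F s] (Z s) :=
    ((hWm s hs hsT).mono (F.mono (by omega)) le_rfl).inner
      ((hmeas s hs hsT).sub ((hf'm s hs hsT).mono (F.mono (by omega)) le_rfl))
  have hσm (s : ℕ) (hs : 1 ≤ s) (hsT : s ≤ T) : Measurable[F (s - 1)] (σ s) :=
    (measurable_norm.comp (hWm s hs hsT)).const_mul G
  have hσ1 (s : ℕ) (ω : Ω) : σ s ω ≤ 1 :=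
    mul_norm_truncatedWeight_le_one hG0 hε (hv_nonneg _ ω) fun hp => by
      refine (hgradG _ hp).trans ?_
      rw [hGsq, hX]
      have : 0 ≤ L * B * Δ := by positivity
      have : 0 ≤ L * Δ := by positivity
      linarith
  have hZσ (s : ℕ) (hs : 1 ≤ s) (hsT : s ≤ T) : ∀ᵐ ω ∂μ, |Z s ω| ≤ σ s ω := by
    filter_upwards [hA3 s hs hsT] with ω hω
    refine abs_inner_truncatedWeight_le hG0 fun hp => hω.trans ?_
    have h1 := mul_le_mul_of_nonneg_left (hgradG _ hp) hB.le
    rw [hGsq, hX]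
    have : 0 ≤ L * B * Δ := by positivity
    have : 0 ≤ L * Δ := by positivity
    linarith
  set K : ℝ := ‖fgrad x1‖ + L * (T * (η * √d)) with hK
  have hf'K (s : ℕ) (hs : 1 ≤ s) (hsT : s ≤ T) (ω : Ω) : ‖fgrad (x s ω)‖ ≤ K := by
    have h1 := adagrad_norm_sub_le (v := fun s => v s ω) (g := fun s => g s ω)
      (x := fun s => x s ω) hη hε (hv0 ω) (fun s hs => hv s hs ω) (fun s hs => hxrec s hs ω)
      hs hsT
    simp only [hx1] at h1
    have h2 := norm_le_norm_sub_add (fgrad (x s ω)) (fgrad x1)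
    have h3 := (hsmooth (x s ω) x1).trans (mul_le_mul_of_nonneg_left h1 hL.le)
    linarith
  have hf'_int (s : ℕ) (hs : 1 ≤ s) (hsT : s ≤ T) :
      Integrable (fun ω => fgrad (x s ω)) μ :=
    Integrable.of_bound ((hf'm s hs hsT).mono (F.le _) le_rfl).aestronglyMeasurable K
      (ae_of_all _ (hf'K s hs hsT))
  have hg_int (s : ℕ) (hs : 1 ≤ s) (hsT : s ≤ T) : Integrable (g s) μ := by
    refine Integrable.of_bound ((hmeas s hs hsT).mono (F.le _) le_rfl).aestronglyMeasurable
      (√(2 * (B + 1) * K ^ 2 + 2 * C)) ?_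
    filter_upwards [hA3 s hs hsT] with ω hω
    refine le_sqrt_of_sq_le ((norm_sq_le_of_affine_noise hω).trans ?_)
    gcongr
    exact hf'K s hs hsT ω
  have hmean (s : ℕ) (hs : 1 ≤ s) (hsT : s ≤ T) : μ[Z s | F (s - 1)] =ᵐ[μ] 0 := by
    refine condExp_inner_sub_eq_zero (F.le _) (hWm s hs hsT).stronglyMeasurable
      (hf'm s hs hsT).stronglyMeasurable (hg_int s hs hsT) (hf'_int s hs hsT) (hA2 s hs hsT) ?_
    refine Integrable.of_bound ((hZm s hs hsT).mono (F.le _) le_rfl).aestronglyMeasurable 1 ?_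
    filter_upwards [hZσ s hs hsT] with ω hω
    exact hω.trans (hσ1 s ω)
  have hbad := measure_exists_log_lt_sum_sub_half_sq_le F hδ0 hZm hσm hZσ
    (fun s _ _ ω => hσ1 s ω) hmean
  set bad : Set Ω := {ω | ∃ t, 1 ≤ t ∧ t ≤ T ∧
    log (T / δ) < ∑ s ∈ Icc 1 t, (Z s ω - σ s ω ^ 2 / 2)}
  set good : Set Ω := {ω | 1 / (T : ℝ) * ∑ s ∈ Finset.Icc 1 T, ‖fgrad (x s ω)‖ ^ 2 ≤
    2 * (Δ / η) * (((B + 1) * (Δ / η) + G + ε) / (T : ℝ) + √(2 * C / (T : ℝ)))}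
  have hA3' : ∀ᵐ ω ∂μ, ∀ s, 1 ≤ s → s ≤ T →
      ‖g s ω - fgrad (x s ω)‖ ^ 2 ≤ B * ‖fgrad (x s ω)‖ ^ 2 + C := by
    refine ae_all_iff.2 fun s => ?_
    by_cases h : 1 ≤ s ∧ s ≤ T
    · filter_upwards [hA3 s h.1 h.2] with ω hω _ _ using hω
    · exact ae_of_all _ fun ω h1 h2 => absurd ⟨h1, h2⟩ h
  have hgood : ∀ᵐ ω ∂μ, ω ∈ badᶜ → ω ∈ good := by
    filter_upwards [hA3'] with ω hω hωbad
    have hpath := adagrad_sum_norm_gradient_sq_le (v := fun s => v s ω) (g := fun s => g s ω)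
      (x := fun s => x s ω) hη hε hL hB hC hT hδ0 hδ1 (hv0 ω) (fun s hs => hv s hs ω)
      (fun s hs => hxrec s hs ω) hgrad hsmooth hfstar hω hX (by simpa only [hx1] using hFT)
      (by simpa only [hx1] using hΔ) hG ?_
    · have hsqrt : √(2 * C * T) = T * √(2 * C / T) := by
        rw [show 2 * C * T = T ^ 2 * (2 * C / T) by field_simp,
          sqrt_mul (by positivity), sqrt_sq (by positivity)]
      rw [hsqrt] at hpath
      change 1 / (T : ℝ) * ∑ s ∈ Finset.Icc 1 T, ‖fgrad (x s ω)‖ ^ 2 ≤ _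
      rw [one_div, inv_mul_le_iff₀ (by positivity)]
      refine hpath.trans_eq ?_
      field_simp
      ring
    · intro t ht1 htT hsub
      have hle : ∑ s ∈ Icc 1 t, (Z s ω - σ s ω ^ 2 / 2) ≤ log (T / δ) := by
        by_contra! hlt
        exact hωbad ⟨t, ht1, htT, hlt⟩
      have hterm : ∑ s ∈ Icc 1 t, (-(1 / (3 * G)) * ∑ i, fgrad (x s ω) i *
            (g s ω i - fgrad (x s ω) i) / (√(v (s - 1) ω i + G ^ 2) + ε) -
          1 / (18 * G) * ∑ i, fgrad (x s ω) i ^ 2 / (√(v (s - 1) ω i + G ^ 2) + ε)) ≤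
          ∑ s ∈ Icc 1 t, (Z s ω - σ s ω ^ 2 / 2) := by
        refine sum_le_sum fun s hs => ?_
        rw [mem_Icc] at hs
        have h1 := sq_mul_norm_truncatedWeight_le (f' := fgrad) hG0 hε (hv_nonneg (s - 1) ω)
          (hsub s hs.1 hs.2)
        have h2 := inner_truncatedWeight (f' := fgrad) (G := G) (ε := ε) (v := v (s - 1) ω)
          (hsub s hs.1 hs.2) (g s ω)
        simp only [hZ, hσ, hW]
        rw [h2]
        have h3 : 1 / (18 * G) = 1 / (9 * G) / 2 := by field_simp; norm_num
        rw [h3]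
        linarith
      have hfin := mul_le_mul_of_nonneg_left (hterm.trans hle) (by positivity : 0 ≤ 3 * G)
      rw [sum_sub_distrib, ← mul_sum, ← mul_sum, mul_sub, ← mul_assoc, ← mul_assoc,
        show 3 * G * -(1 / (3 * G)) = -1 by field_simp,
        show 3 * G * (1 / (18 * G)) = 1 / 6 by field_simp; norm_num] at hfin
      linarith
  have hcover : (1 : ENNReal) ≤ μ good + μ bad := by
    calc (1 : ENNReal) = μ Set.univ := measure_univ.symm
      _ = μ (good ∪ bad) := by
        refine measure_congr ?_
        filter_upwards [hgood] with ω hω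
        have : ω ∈ good ∪ bad := by
          by_cases h : ω ∈ bad
          · exact Or.inr h
          · exact Or.inl (hω h)
        exact propext ⟨fun _ => this, fun _ => trivial⟩
      _ ≤ μ good + μ bad := measure_union_le _ _
  rw [ENNReal.ofReal_sub _ hδ0.le, ENNReal.ofReal_one]
  exact tsub_le_iff_right.2 (hcover.trans (by gcongr))
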